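/- Let S be a submodule of a module G over a principal ideal domain R, p a prime of R, and α an ordinal. Set S_α = S ∩ p^α G and S_α* = S_α ∩ {x ∈ G : px ∈ p^{α+2} G}. For x ∈ S_α*, choose y ∈ p^{α+1} G with px = py, and map x to the coset (x − y) + (p^{α+1} G)[p] in (p^α G)[p]/(p^{α+1} G)[p]. Then: (1) this map is well-defined (independent of the choice of y); (2) its kernel is exactly S_{α+1}; (3) the induced map U : S_α*/S_{α+1} → (p^α G)[p]/(p^{α+1} G)[p] is an injective module homomorphism; and (4) U fails to be surjective if and only if there exists an element of (p^α G)[p] of p-height exactly α that is proper with respect to S. -/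

import Mathlib

noncomputable section

namespace UlmW

universe u

variable {R : Type*} [CommRing R]

/-- The submodule `p^α M`, defined by transfinite recursion on `α`. -/
def ppow {M : Type u} [AddCommGroup M] [Module R M] (p : R) (α : Ordinal.{u}) :
    Submodule R M :=
  Ordinal.limitRecOn α ⊤ (fun _ S => Submodule.map (LinearMap.lsmul R M p) S)
    fun β _ ih => ⨅ (γ : Set.Iio β), ih γ.1 γ.2

open scoped Classical in
/-- The `p`-height of `x`, with `⊤` playing the role of `∞`. -/
def pheight {M : Type u} [AddCommGroup M] [Module R M] (p : R) (x : M) :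
    WithTop Ordinal.{u} :=
  if h : ∃ α : Ordinal.{u}, x ∈ ppow p α ∧ x ∉ ppow p (α + 1) then (h.choose : WithTop Ordinal)
  else ⊤

/-- `H⁰ = {x : ∃ a ≠ 0, a • x ∈ H}`. -/
def hull {M : Type u} [AddCommGroup M] [Module R M] (H : Submodule R M) : Set M :=
  {x | ∃ a : R, a ≠ 0 ∧ a • x ∈ H}

/-- `X` is a decomposition set with respect to the single prime `p`. -/
def IsDecompWrt {M : Type u} [AddCommGroup M] [Module R M] (p : R) (X : Set M) : Prop :=
  (LinearIndependent R (fun x : X => (x : M))) ∧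
  (∀ x ∈ X, ∀ a : R, a ≠ 0 → a • x ≠ 0) ∧
  (∀ s : Finset M, ↑s ⊆ X → ∀ c : M → R,
    pheight p (∑ x ∈ s, c x • x) = s.inf fun x => pheight p (c x • x))

/-- `X` is a decomposition set (with respect to every prime of `R`). -/
def IsDecompositionSet (R : Type*) [CommRing R] {M : Type u} [AddCommGroup M] [Module R M]
    (X : Set M) : Prop :=
  ∀ p : R, Prime p → IsDecompWrt p X

/-- partial decomposition basis, heights taken w.r.t. a fixed prime `p`. -/
def IsPDBWrt {M : Type u} [AddCommGroup M] [Module R M] (p : R) (C : Set (Set M)) : Prop :=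
  C.Nonempty ∧ (∀ X ∈ C, X.Finite) ∧ (∀ X ∈ C, IsDecompWrt p X) ∧
  ∀ X ∈ C, ∀ x : M, ∃ Y ∈ C, X ⊆ Y ∧ x ∈ hull (Submodule.span R Y)

/-- partial decomposition basis (heights w.r.t. all primes of `R`). -/
def IsPDB (R : Type*) [CommRing R] {M : Type u} [AddCommGroup M] [Module R M] (C : Set (Set M)) : Prop :=
  C.Nonempty ∧ (∀ X ∈ C, X.Finite) ∧ (∀ X ∈ C, IsDecompositionSet R X) ∧
  ∀ X ∈ C, ∀ x : M, ∃ Y ∈ C, X ⊆ Y ∧ x ∈ hull (Submodule.span R Y)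

/-- A partial isomorphism system `I : G ≅_p H`. -/
def IsPartialIsoSystem {M N : Type*} [AddCommGroup M] [Module R M]
    [AddCommGroup N] [Module R N] (I : Set (M →ₗ.[R] N)) : Prop :=
  I.Nonempty ∧
  (∀ f ∈ I, Function.Injective f.toFun) ∧
  (∀ f ∈ I, ∀ a : M, ∃ g ∈ I, f ≤ g ∧ a ∈ g.domain) ∧
  (∀ f ∈ I, ∀ b : N, ∃ g ∈ I, f ≤ g ∧ ∃ y : g.domain, g y = b)

/-- The Ulm sequence of `x`: `U(x) = (|pⁱ x|)ᵢ`. -/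
def UlmSeqOf {M : Type u} [AddCommGroup M] [Module R M] (p : R) (x : M) :
    ℕ → WithTop Ordinal.{u} :=
  fun i => pheight p ((p ^ i) • x)

/-- `u` is an Ulm sequence. -/
def IsUlmSeq (u : ℕ → WithTop Ordinal.{u}) : Prop :=
  ∀ i, (u i = ⊤ → u (i + 1) = ⊤) ∧ (u i ≠ ⊤ → u i < u (i + 1))

/-- Equivalence of Ulm sequences. -/
def UlmEquiv (u v : ℕ → WithTop Ordinal.{u}) : Prop :=
  ∃ m n : ℕ, ∀ i, u (i + n) = v (i + m)

/-- `X` contains at least `n` elements whose Ulm sequence is equivalent to `u`. -/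
def HasAtLeast {M : Type u} [AddCommGroup M] [Module R M] (p : R)
    (u : ℕ → WithTop Ordinal.{u}) (n : ℕ) (X : Set M) : Prop :=
  ∃ s : Finset M, ↑s ⊆ X ∧ n ≤ s.card ∧ ∀ x ∈ s, UlmEquiv (UlmSeqOf p x) u

/-- `ŵ_C(e,G)` where `e` is the class of the Ulm sequence `u`. -/
def wHat {M : Type u} [AddCommGroup M] [Module R M] (p : R) (C : Set (Set M))
    (u : ℕ → WithTop Ordinal.{u}) : ℕ∞ :=
  sSup {N : ℕ∞ | ∃ n : ℕ, N = (n : ℕ∞) ∧ ∃ X ∈ C, HasAtLeast p u n X}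

/-- `x` is proper with respect to `S`. -/
def IsProper {M : Type u} [AddCommGroup M] [Module R M] (p : R) (S : Submodule R M)
    (x : M) : Prop :=
  ∀ s ∈ S, pheight p (x + s) ≤ pheight p x

/-- `H` is a nice submodule. -/
def IsNice {M : Type u} [AddCommGroup M] [Module R M] (p : R) (H : Submodule R M) : Prop :=
  ∀ x : M, ∃ h ∈ H, ∀ h' ∈ H, pheight p (x + h') ≤ pheight p (x + h)

/-- The Ulm invariant `u_p(σ, M)`: the dimension of `(p^σ M)[p]/(p^{σ+1} M)[p]`
over the residue field `R/(p)`. -/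
def uCard (p : R) (M : Type u) [AddCommGroup M] [Module R M] (σ : Ordinal.{u}) :
    Cardinal :=
  let V : Submodule R M := ppow p σ ⊓ Submodule.torsionBy R M p
  let W : Submodule R V := (ppow p (σ + 1) ⊓ Submodule.torsionBy R M p).comap V.subtype
  Module.rank (R ⧸ Ideal.span {p})
    ((V ⧸ W) ⧸ (Ideal.span {p} • (⊤ : Submodule R (V ⧸ W))))

/-- `û_p(σ, M) = min (u_p(σ, M), ω)`. -/
def uHat (p : R) (M : Type u) [AddCommGroup M] [Module R M] (σ : Ordinal.{u}) : Cardinal :=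
  min (uCard p M σ) Cardinal.aleph0

/-- `û_p(∞, M) = min (dim (p^∞ M)[p], ω)`. -/
def uHatInf (p : R) (M : Type u) [AddCommGroup M] [Module R M] : Cardinal :=
  let V : Submodule R M := (⨅ α : Ordinal.{u}, ppow p α) ⊓ Submodule.torsionBy R M p
  min (Module.rank (R ⧸ Ideal.span {p})
    (V ⧸ (Ideal.span {p} • (⊤ : Submodule R V)))) Cardinal.aleph0

end UlmW

open UlmW

/-- The ideal `(p) ⊆ ℤ` is prime. -/
instance zpSpanPrime (p : ℤ) [hp : Fact (Prime p)] : (Ideal.span {p} : Ideal ℤ).IsPrime :=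
  (Ideal.span_singleton_prime hp.out.ne_zero).mpr hp.out

/-- `ℤ_(p)`, the integers localized at the prime `p`. -/
abbrev Zp (p : ℤ) [Fact (Prime p)] : Type :=
  Localization.AtPrime (Ideal.span {p} : Ideal ℤ)


universe u

open UlmW

/-- `S_α^* = (S ∩ p^α G) ∩ {x : p x ∈ p^(α+2) G}`. -/
def Sstar {R : Type*} [CommRing R] {G : Type u} [AddCommGroup G] [Module R G]
    (p : R) (S : Submodule R G) (α : Ordinal.{u}) : Submodule R G :=
  S ⊓ ppow p α ⊓ (ppow p (α + 2)).comap (LinearMap.lsmul R G p)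

/-- `(p^α G)[p]`. -/
def pSoc {R : Type*} [CommRing R] {G : Type u} [AddCommGroup G] [Module R G]
    (p : R) (α : Ordinal.{u}) : Submodule R G :=
  ppow p α ⊓ Submodule.torsionBy R G p

namespace UlmW

section Heights

variable {R : Type*} [CommRing R] {M : Type u} [AddCommGroup M] [Module R M]

theorem ppow_add_one (p : R) (α : Ordinal.{u}) :
    ppow (M := M) p (α + 1) = (ppow p α).map (LinearMap.lsmul R M p) :=
  Ordinal.limitRecOn_add_one ..

theorem ppow_limit (p : R) {α : Ordinal.{u}} (h : Order.IsSuccLimit α) :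
    ppow (M := M) p α = ⨅ γ : Set.Iio α, ppow p γ.1 :=
  Ordinal.limitRecOn_limit (h := h) ..

theorem ppow_zero (p : R) : ppow (M := M) p (0 : Ordinal.{u}) = ⊤ :=
  Ordinal.limitRecOn_zero ..

theorem mem_ppow_add_one {p : R} {α : Ordinal.{u}} {x : M} :
    x ∈ ppow p (α + 1) ↔ ∃ y ∈ ppow p α, p • y = x := by
  simp [ppow_add_one]

theorem mem_ppow_add_two {p : R} {α : Ordinal.{u}} {x : M} :
    x ∈ ppow p (α + 2) ↔ ∃ y ∈ ppow p (α + 1), p • y = x := by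
  rw [← one_add_one_eq_two, ← add_assoc, mem_ppow_add_one]

theorem ppow_add_one_le (p : R) (α : Ordinal.{u}) :
    ppow (M := M) p (α + 1) ≤ ppow p α := by
  intro x hx
  obtain ⟨y, hy, rfl⟩ := mem_ppow_add_one.1 hx
  exact Submodule.smul_mem _ p hy

theorem ppow_antitone (p : R) : Antitone (fun α : Ordinal.{u} => ppow (M := M) p α) := by
  intro α β
  induction β using Ordinal.limitRecOn with
  | zero =>
    intro h
    rw [nonpos_iff_eq_zero.1 h]
  | add_one β ih =>
    intro h
    rcases h.eq_or_lt with rfl | h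
    · exact le_rfl
    · exact (ppow_add_one_le p β).trans (ih (Order.lt_add_one_iff.1 h))
  | limit β hβ _ =>
    intro h
    rcases h.eq_or_lt with rfl | h
    · exact le_rfl
    · simp only [ppow_limit p hβ]
      exact iInf_le (fun γ : Set.Iio β => ppow (M := M) p γ.1) ⟨α, h⟩

theorem pheight_eq_coe_of_mem_of_notMem {p : R} {x : M} {α : Ordinal.{u}}
    (h : x ∈ ppow p α) (h' : x ∉ ppow p (α + 1)) : pheight p x = (α : WithTop Ordinal.{u}) := by
  have hex : ∃ α : Ordinal.{u}, x ∈ ppow p α ∧ x ∉ ppow p (α + 1) := ⟨α, h, h'⟩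
  obtain ⟨h₁, h₂⟩ := hex.choose_spec
  rw [pheight, dif_pos hex, WithTop.coe_inj]
  apply le_antisymm
  · by_contra! hlt
    exact h' (ppow_antitone p (Order.add_one_le_of_lt hlt) h₁)
  · by_contra! hlt
    exact h₂ (ppow_antitone p (Order.add_one_le_of_lt hlt) h)

theorem exists_mem_ppow_notMem_ppow_add_one {p : R} {x : M} {β : Ordinal.{u}}
    (h : x ∉ ppow p β) : ∃ γ < β, x ∈ ppow p γ ∧ x ∉ ppow p (γ + 1) := by
  induction β using Ordinal.limitRecOn with
  | zero => simp [ppow_zero] at h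
  | add_one β ih =>
    by_cases hx : x ∈ ppow p β
    · exact ⟨β, lt_add_one β, hx, h⟩
    · obtain ⟨γ, hγ, hγx⟩ := ih hx
      exact ⟨γ, hγ.trans (lt_add_one β), hγx⟩
  | limit β hβ ih =>
    simp only [ppow_limit p hβ, Submodule.mem_iInf, not_forall] at h
    obtain ⟨⟨δ, hδ⟩, hx⟩ := h
    obtain ⟨γ, hγ, hγx⟩ := ih δ hδ hx
    exact ⟨γ, hγ.trans hδ, hγx⟩

theorem pheight_le_coe_iff {p : R} {x : M} {α : Ordinal.{u}} :
    pheight p x ≤ (α : WithTop Ordinal.{u}) ↔ x ∉ ppow p (α + 1) := by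
  constructor
  · intro h hx
    by_cases hex : ∃ β : Ordinal.{u}, x ∈ ppow p β ∧ x ∉ ppow p (β + 1)
    · obtain ⟨β, hβ, hβ'⟩ := hex
      rw [pheight_eq_coe_of_mem_of_notMem hβ hβ', WithTop.coe_le_coe] at h
      exact hβ' (ppow_antitone p (add_le_add_left h 1) hx)
    · simp [pheight, hex] at h
  · intro h
    obtain ⟨γ, hγ, hx, hx'⟩ := exists_mem_ppow_notMem_ppow_add_one h
    rw [pheight_eq_coe_of_mem_of_notMem hx hx', WithTop.coe_le_coe]
    exact Order.lt_add_one_iff.1 hγ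

theorem pheight_eq_and_isProper_iff {p : R} {S : Submodule R M} {α : Ordinal.{u}} {z : M}
    (hz : z ∈ ppow p α) :
    (pheight p z = (α : WithTop Ordinal.{u}) ∧ IsProper p S z) ↔
      ∀ s ∈ S, z - s ∉ ppow p (α + 1) := by
  constructor
  · rintro ⟨h, hprop⟩ s hs
    rw [← pheight_le_coe_iff, ← h, sub_eq_add_neg]
    exact hprop _ (S.neg_mem hs)
  · intro h
    have hα := pheight_eq_coe_of_mem_of_notMem hz (by simpa using h 0 S.zero_mem)
    refine ⟨hα, fun s hs => ?_⟩
    rw [hα, pheight_le_coe_iff, ← sub_neg_eq_add]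
    exact h _ (S.neg_mem hs)

end Heights

section UlmMap

variable {R : Type*} [CommRing R] {G : Type u} [AddCommGroup G] [Module R G]
  {p : R} {S : Submodule R G} {α : Ordinal.{u}}

theorem mem_pSoc {x : G} : x ∈ pSoc p α ↔ x ∈ ppow p α ∧ p • x = 0 := by
  simp [pSoc]

theorem mem_Sstar {x : G} :
    x ∈ Sstar p S α ↔ (x ∈ S ∧ x ∈ ppow p α) ∧ p • x ∈ ppow p (α + 2) := by
  simp [Sstar]

theorem sub_mem_pSoc {x y : G} (hx : x ∈ ppow p α) (hy : y ∈ ppow p (α + 1))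
    (h : p • x = p • y) : x - y ∈ pSoc p α :=
  mem_pSoc.2 ⟨Submodule.sub_mem _ hx (ppow_add_one_le p α hy), by rw [smul_sub, h, sub_self]⟩

theorem exists_ppow_smul_eq (x : Sstar p S α) :
    ∃ y ∈ ppow p (α + 1), p • (x : G) = p • y := by
  obtain ⟨y, hy, h⟩ := mem_ppow_add_two.1 (mem_Sstar.1 x.2).2
  exact ⟨y, hy, h.symm⟩

/-- An element of `S` congruent to an element of `(p^α G)[p]` modulo `p^(α+1) G` is in `S_α^*`. -/
theorem mem_Sstar_of_sub_mem {z s : G} (hz : z ∈ pSoc p α) (hs : s ∈ S)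
    (h : z - s ∈ ppow p (α + 1)) : s ∈ Sstar p S α := by
  obtain ⟨hz, hpz⟩ := mem_pSoc.1 hz
  refine mem_Sstar.2 ⟨⟨hs, ?_⟩, mem_ppow_add_two.2 ⟨-(z - s), Submodule.neg_mem _ h, ?_⟩⟩
  · simpa using Submodule.sub_mem _ hz (ppow_add_one_le p α h)
  · simp [smul_sub, hpz]

theorem mk_pSoc_eq_iff {a b : pSoc (G := G) p α} :
    (Submodule.Quotient.mk a : ↥(pSoc p α) ⧸ ((pSoc p (α + 1)).comap (pSoc (G := G) p α).subtype)) =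
      Submodule.Quotient.mk b ↔ (a : G) - b ∈ ppow p (α + 1) := by
  have ha := (mem_pSoc.1 a.2).2
  have hb := (mem_pSoc.1 b.2).2
  simp [Submodule.Quotient.eq, mem_pSoc, smul_sub, ha, hb]

/-- The map `S_α^* → (p^α G)[p] / (p^(α+1) G)[p]` sending `x` to the class of `x - y`, where
`y ∈ p^(α+1) G` satisfies `p x = p y`. -/
def ulmMap (p : R) (S : Submodule R G) (α : Ordinal.{u}) :
    Sstar p S α →ₗ[R] ↥(pSoc (G := G) p α) ⧸ ((pSoc p (α + 1)).comap (pSoc p α).subtype) where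
  toFun x := Submodule.Quotient.mk ⟨x - (exists_ppow_smul_eq x).choose,
    sub_mem_pSoc (mem_Sstar.1 x.2).1.2 (exists_ppow_smul_eq x).choose_spec.1
      (exists_ppow_smul_eq x).choose_spec.2⟩
  map_add' x x' := by
    rw [← Submodule.Quotient.mk_add, mk_pSoc_eq_iff]
    have h := (exists_ppow_smul_eq (x + x')).choose_spec.1
    have h₁ := (exists_ppow_smul_eq x).choose_spec.1
    have h₂ := (exists_ppow_smul_eq x').choose_spec.1
    convert Submodule.sub_mem _ (Submodule.add_mem _ h₁ h₂) h using 1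
    simp only [Submodule.coe_add]
    abel
  map_smul' r x := by
    rw [RingHom.id_apply, ← Submodule.Quotient.mk_smul, mk_pSoc_eq_iff]
    have h := (exists_ppow_smul_eq (r • x)).choose_spec.1
    have h₁ := (exists_ppow_smul_eq x).choose_spec.1
    convert Submodule.sub_mem _ (Submodule.smul_mem _ r h₁) h using 1
    simp only [Submodule.coe_smul, smul_sub]
    abel

theorem ulmMap_eq_mk_iff {x : Sstar p S α} {z : pSoc (G := G) p α} :
    ulmMap p S α x = Submodule.Quotient.mk z ↔ (z : G) - x ∈ ppow p (α + 1) := by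
  have h := (exists_ppow_smul_eq x).choose_spec.1
  refine mk_pSoc_eq_iff.trans ?_
  rw [← Submodule.neg_mem_iff, ← Submodule.sub_mem_iff_left _ h]
  congr! 1
  simp only
  abel

theorem ker_ulmMap :
    LinearMap.ker (ulmMap p S α) = (S ⊓ ppow p (α + 1)).comap (Sstar p S α).subtype := by
  ext x
  have hx := (mem_Sstar.1 x.2).1.1
  rw [LinearMap.mem_ker, ← Submodule.Quotient.mk_zero, ulmMap_eq_mk_iff]
  simp [hx]

theorem mk_mem_range_ulmMap_iff {z : pSoc (G := G) p α} :
    (∃ x, ulmMap p S α x = Submodule.Quotient.mk z) ↔ ∃ s ∈ S, (z : G) - s ∈ ppow p (α + 1) := by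
  simp only [ulmMap_eq_mk_iff]
  constructor
  · rintro ⟨x, hx⟩
    exact ⟨x, (mem_Sstar.1 x.2).1.1, hx⟩
  · rintro ⟨s, hs, h⟩
    exact ⟨⟨s, mem_Sstar_of_sub_mem z.2 hs h⟩, h⟩

theorem not_surjective_ulmMap_iff :
    ¬ Function.Surjective (ulmMap p S α) ↔
      ∃ z ∈ pSoc p α, pheight p z = (α : WithTop Ordinal.{u}) ∧ IsProper p S z := by
  rw [Function.Surjective, (Submodule.Quotient.mk_surjective _).forall]
  simp only [mk_mem_range_ulmMap_iff, Subtype.forall, not_forall, not_exists, not_and,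
    exists_prop]
  exact exists_congr fun z => and_congr_right fun hz =>
    (pheight_eq_and_isProper_iff (mem_pSoc.1 hz).1).symm

end UlmMap

end UlmW

theorem statement_7 {R : Type*} [CommRing R] [IsDomain R] [IsPrincipalIdealRing R]
    {G : Type u} [AddCommGroup G] [Module R G]
    (p : R) (hp : Prime p) (S : Submodule R G) (α : Ordinal.{u}) :
    ∃ U : (↥(Sstar p S α) ⧸ ((S ⊓ ppow p (α + 1)).comap (Sstar p S α).subtype)) →ₗ[R]
          (↥(pSoc p α) ⧸ ((pSoc p (α + 1)).comap (pSoc p α).subtype)),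
      (∀ x : Sstar p S α, ∃ y ∈ ppow p (α + 1),
        p • (x : G) = p • y ∧ (x : G) - y ∈ pSoc p α) ∧
      (∀ (x : Sstar p S α) (y : G), y ∈ ppow p (α + 1) → p • (x : G) = p • y →
        ∀ h : (x : G) - y ∈ pSoc p α,
          U (Submodule.Quotient.mk x) =
            Submodule.Quotient.mk (⟨(x : G) - y, h⟩ : pSoc p α)) ∧
      Function.Injective U ∧
      (¬ Function.Surjective U ↔
        ∃ z ∈ pSoc p α, pheight p z = (α : WithTop Ordinal.{u}) ∧ IsProper p S z) := by
  refine ⟨Submodule.liftQ _ (ulmMap p S α) ker_ulmMap.ge, fun x => ?_, fun x y hy _ h => ?_,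
    ?_, ?_⟩
  · obtain ⟨y, hy, h⟩ := exists_ppow_smul_eq x
    exact ⟨y, hy, h, sub_mem_pSoc (mem_Sstar.1 x.2).1.2 hy h⟩
  · rw [Submodule.liftQ_apply, ulmMap_eq_mk_iff]
    simpa using hy
  · exact LinearMap.ker_eq_bot.1 (Submodule.ker_liftQ_eq_bot _ _ _ ker_ulmMap.le)
  · rw [← not_surjective_ulmMap_iff, ← LinearMap.range_eq_top, ← LinearMap.range_eq_top,
      Submodule.range_liftQ]
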